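/- arXiv:2409.10745 — 3 statements merged into one kernel-verified Lean document; each statement's English description precedes it below -/
import Mathlib

section
/- Let G be a countably infinite discrete group and H ≤ G with H contained in the center Z(G) and [G:H] < +∞. If (X,H,α) is a topological dynamical system and (X_H^G, G, α^{H\G}) is the co-induced system, then h*_{top}(X_H^G, G) = [G:H] · h*_{top}(X,H). -/
open Filter Topology Set
open scoped ENNReal Classical

section EntropyDefs

variable {G X : Type*}

/-- `𝒰` is an open cover of `X`. -/
def IsOpenCover [TopologicalSpace X] (𝒰 : Set (Set X)) : Prop :=
  (∀ U ∈ 𝒰, IsOpen U) ∧ ⋃₀ 𝒰 = Set.univ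

/-- `N(𝒰)`: the minimal cardinality of a finite subcover of `𝒰`
(junk value `0` if no finite subcover exists). -/
noncomputable def coverN (𝒰 : Set (Set X)) : ℕ :=
  sInf {n : ℕ | ∃ F : Finset (Set X), ↑F ⊆ 𝒰 ∧ F.card = n ∧ ⋃₀ (F : Set (Set X)) = Set.univ}

/-- The join `⋁_{i=1}^n α_{g_i⁻¹}(𝒰)` of the covers `α_{g_i⁻¹}(𝒰) = (α g_i)⁻¹'(𝒰)`. -/
def joinPull (α : G → X → X) (𝒰 : Set (Set X)) {n : ℕ} (g : Fin n → G) : Set (Set X) :=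
  {V | ∃ U : Fin n → Set X, (∀ i, U i ∈ 𝒰) ∧ V = ⋂ i, α (g i) ⁻¹' U i}

/-- Topological sequence entropy of the cover `𝒰` along the sequence `𝔰`:
`h_top^𝔰(𝒰,G) = limsup_n (1/n) log N(⋁_{i=1}^n α_{𝔰(i)⁻¹}(𝒰))`, valued in `[0,∞]`. -/
noncomputable def seqEntCover (α : G → X → X) (𝔰 : ℕ → G) (𝒰 : Set (Set X)) : ℝ≥0∞ :=
  Filter.atTop.limsup fun n : ℕ =>
    ENNReal.ofReal (Real.log (coverN (joinPull α 𝒰 fun i : Fin n => 𝔰 i)) / n)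

/-- Topological sequence entropy of the action along `𝔰`: supremum over all open covers. -/
noncomputable def seqEnt [TopologicalSpace X] (α : G → X → X) (𝔰 : ℕ → G) : ℝ≥0∞ :=
  ⨆ 𝒰 ∈ {𝒰 : Set (Set X) | IsOpenCover 𝒰}, seqEntCover α 𝔰 𝒰

/-- `p*_{X,G,𝒰}(n) = max_{(g_1,…,g_n) ∈ Gⁿ} N(⋁_{i=1}^n α_{g_i⁻¹}(𝒰))`. -/
noncomputable def patN (α : G → X → X) (𝒰 : Set (Set X)) (n : ℕ) : ℕ :=
  sSup {m : ℕ | ∃ g : Fin n → G, m = coverN (joinPull α 𝒰 g)}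

/-- Maximal pattern entropy of the cover `𝒰`: `lim_n (1/n) log p*_{X,G,𝒰}(n)`
(the limit exists by subadditivity and coincides with the limsup used here). -/
noncomputable def patEntCover (α : G → X → X) (𝒰 : Set (Set X)) : ℝ≥0∞ :=
  Filter.atTop.limsup fun n : ℕ => ENNReal.ofReal (Real.log (patN α 𝒰 n) / n)

/-- Maximal pattern entropy `h*_top(X,G)`: supremum over all open covers. -/
noncomputable def patEnt [TopologicalSpace X] (α : G → X → X) : ℝ≥0∞ :=
  ⨆ 𝒰 ∈ {𝒰 : Set (Set X) | IsOpenCover 𝒰}, patEntCover α 𝒰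

/-- `α` is an action of `G` on `X` by homeomorphisms. -/
def IsActionBy [Group G] [TopologicalSpace X] (α : G → X → X) : Prop :=
  (∀ x, α 1 x = x) ∧ (∀ g h x, α (g * h) x = α g (α h x)) ∧ ∀ g, Continuous (α g)

/-- `I ⊆ G` is an independence set for the tuple `(A 1, …, A k)`:
for every nonempty finite `F ⊆ I` and every `ω : F → {1,…,k}` we have
`⋂_{g ∈ F} α_{g⁻¹}(A (ω g)) ≠ ∅`. -/
def IsIndepSet (α : G → X → X) {k : ℕ} (A : Fin k → Set X) (I : Set G) : Prop :=
  ∀ F : Finset G, ↑F ⊆ I → F.Nonempty → ∀ ω : G → Fin k,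
    (⋂ g ∈ F, α g ⁻¹' A (ω g)).Nonempty

/-- The tuple `(A 1, …, A k)` has arbitrarily large finite independence sets. -/
def HasArbLargeIndep (α : G → X → X) {k : ℕ} (A : Fin k → Set X) : Prop :=
  ∀ n : ℕ, ∃ F : Finset G, n ≤ F.card ∧ IsIndepSet α A ↑F

/-- `(x 1, …, x k)` is an IN-tuple: every product neighbourhood has arbitrarily large
finite independence sets. -/
def IsINTuple [TopologicalSpace X] (α : G → X → X) {k : ℕ} (x : Fin k → X) : Prop :=
  ∀ U : Fin k → Set X, (∀ i, IsOpen (U i)) → (∀ i, x i ∈ U i) → HasArbLargeIndep α U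

/-- The action `α` of `G` on `X` is (topologically) weak-mixing. -/
def IsWeakMixing [TopologicalSpace X] (α : G → X → X) : Prop :=
  ∀ U₁ U₂ V₁ V₂ : Set X, IsOpen U₁ → IsOpen U₂ → IsOpen V₁ → IsOpen V₂ →
    U₁.Nonempty → U₂.Nonempty → V₁.Nonempty → V₂.Nonempty →
    ∃ g : G, (U₁ ∩ α g '' V₁).Nonempty ∧ (U₂ ∩ α g '' V₂).Nonempty

/-- `(x₁,x₂)` is a sequence entropy pair. -/
def IsSeqEntropyPair [TopologicalSpace X] (α : G → X → X) (x₁ x₂ : X) : Prop :=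
  x₁ ≠ x₂ ∧ ∀ A₁ A₂ : Set X, IsClosed A₁ → IsClosed A₂ →
    A₁ ∈ nhds x₁ → A₂ ∈ nhds x₂ → Disjoint A₁ A₂ →
    ∃ 𝔰 : ℕ → G, 0 < seqEntCover α 𝔰 {A₁ᶜ, A₂ᶜ}

/-- `(x 1, …, x k)` is a sequence entropy tuple: it is not diagonal, and whenever
`U i` are closed neighbourhoods of the `x i` which coincide on equal coordinates and are
pairwise disjoint on distinct coordinates (i.e. pairwise disjoint closed neighbourhoods of
the distinct points of the tuple), some sequence gives positive sequence entropy for the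
cover by their complements. -/
def IsSeqEntropyTuple [TopologicalSpace X] (α : G → X → X) {k : ℕ} (x : Fin k → X) : Prop :=
  (∃ i j, x i ≠ x j) ∧ ∀ U : Fin k → Set X,
    (∀ i, IsClosed (U i)) → (∀ i, U i ∈ nhds (x i)) →
    (∀ i j, x i = x j → U i = U j) → (∀ i j, x i ≠ x j → Disjoint (U i) (U j)) →
    ∃ 𝔰 : ℕ → G, 0 < seqEntCover α 𝔰 (Set.range fun i => (U i)ᶜ)

end EntropyDefs

namespace CoInd

variable {G : Type*} [Group G] (H : Subgroup G)

/-- `H\G`, the space of right cosets of `H` in `G`. -/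
abbrev RQ := Quotient (QuotientGroup.rightRel H)

/-- Right multiplication `Hg ↦ H(g·g₀)` on the right coset space. -/
def rmul (g₀ : G) : RQ H → RQ H :=
  Quotient.map' (fun g => g * g₀) (fun a b hab => by
    rw [QuotientGroup.rightRel_apply] at hab ⊢
    have h2 : b * g₀ * (a * g₀)⁻¹ = b * a⁻¹ := by group
    rw [h2]; exact hab)

/-- `s : H\G → G` is a section of the right cosets with `s(H) = e`. -/
def IsSection (s : RQ H → G) : Prop :=
  (∀ θ : RQ H, Quotient.mk'' (s θ) = θ) ∧ s (Quotient.mk'' 1) = 1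

variable {X : Type*}

/-- The co-induced action `α^{H\G}` of `G` on `X_H^G = ∏_{θ ∈ H\G} X`, relative to a
section `s` of the right cosets:
`(α^{H\G}_{g₀} f)(Hg) = α_{s(Hg)·g₀·s(Hg·g₀)⁻¹} (f (Hg·g₀))`.
(When `s` is a genuine section the element `s(Hg)·g₀·s(Hg·g₀)⁻¹` always lies in `H`,
so the `else` branch is never taken.) -/
noncomputable def coindAct (α : ↥H → X → X) (s : RQ H → G) (g₀ : G)
    (f : RQ H → X) : RQ H → X := fun θ =>
  if h : s θ * g₀ * (s (rmul H g₀ θ))⁻¹ ∈ H then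
    α ⟨s θ * g₀ * (s (rmul H g₀ θ))⁻¹, h⟩ (f (rmul H g₀ θ))
  else f (rmul H g₀ θ)

end CoInd

section CoverNumber

variable {G X : Type*}

/-- `𝒰` has a finite subcover. -/
def HasFiniteSubcover (𝒰 : Set (Set X)) : Prop :=
  ∃ F : Finset (Set X), ↑F ⊆ 𝒰 ∧ ⋃₀ (F : Set (Set X)) = Set.univ

theorem IsOpenCover.hasFiniteSubcover [TopologicalSpace X] [CompactSpace X]
    {𝒰 : Set (Set X)} (h : IsOpenCover 𝒰) : HasFiniteSubcover 𝒰 := by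
  obtain ⟨T, hT, hfin, hcov⟩ := isCompact_univ.elim_finite_subcover_image (c := id) h.1
    (by rw [← h.2, sUnion_eq_biUnion]; rfl)
  exact ⟨hfin.toFinset, by simpa using hT,
    by simpa [sUnion_eq_biUnion] using univ_subset_iff.mp hcov⟩

theorem HasFiniteSubcover.exists_card_eq_coverN {𝒰 : Set (Set X)} (h : HasFiniteSubcover 𝒰) :
    ∃ F : Finset (Set X), ↑F ⊆ 𝒰 ∧ F.card = coverN 𝒰 ∧ ⋃₀ (F : Set (Set X)) = Set.univ := by
  obtain ⟨F, hF, hcov⟩ := h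
  exact Nat.sInf_mem (s := {n : ℕ | ∃ F : Finset (Set X), ↑F ⊆ 𝒰 ∧ F.card = n ∧
    ⋃₀ (F : Set (Set X)) = Set.univ}) ⟨F.card, F, hF, rfl, hcov⟩

theorem exists_subcover_card_le_of_family {𝒰 : Set (Set X)} {ι : Type*} [Fintype ι]
    (A : ι → Set X) (hA : ∀ i, ∃ U ∈ 𝒰, A i ⊆ U) (hcov : ∀ x, ∃ i, x ∈ A i) :
    ∃ F : Finset (Set X), ↑F ⊆ 𝒰 ∧ ⋃₀ (F : Set (Set X)) = Set.univ ∧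
      F.card ≤ Fintype.card ι := by
  choose U hU hAU using hA
  refine ⟨Finset.univ.image U, ?_, ?_, Finset.card_image_le⟩
  · rintro _ hV
    obtain ⟨i, -, rfl⟩ := Finset.mem_image.mp (Finset.mem_coe.mp hV)
    exact hU i
  · refine eq_univ_of_forall fun x => ?_
    obtain ⟨i, hi⟩ := hcov x
    exact ⟨U i, by simp, hAU i hi⟩

theorem coverN_le_card_of_family {𝒰 : Set (Set X)} {ι : Type*} [Fintype ι]
    (A : ι → Set X) (hA : ∀ i, ∃ U ∈ 𝒰, A i ⊆ U) (hcov : ∀ x, ∃ i, x ∈ A i) :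
    coverN 𝒰 ≤ Fintype.card ι := by
  obtain ⟨F, hF, hFcov, hcard⟩ := exists_subcover_card_le_of_family A hA hcov
  exact le_trans (Nat.sInf_le ⟨F, hF, rfl, hFcov⟩) hcard

theorem card_le_coverN {𝒰 : Set (Set X)} (h : HasFiniteSubcover 𝒰) (E : Finset X)
    (hE : ∀ U ∈ 𝒰, ∀ x ∈ E, ∀ y ∈ E, x ∈ U → y ∈ U → x = y) : E.card ≤ coverN 𝒰 := by
  obtain ⟨F, hF, hcard, hcov⟩ := h.exists_card_eq_coverN
  rw [← hcard]
  have hmem : ∀ x : X, ∃ U ∈ F, x ∈ U := fun x => by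
    obtain ⟨U, hU, hx⟩ := hcov.ge (mem_univ x)
    exact ⟨U, hU, hx⟩
  choose U hU hx using hmem
  refine Finset.card_le_card_of_injOn U (fun x _ => hU x) fun x hxE y hyE hxy => ?_
  exact hE (U x) (hF (hU x)) x hxE y hyE (hx x) (hxy ▸ hx y)

theorem HasFiniteSubcover.joinPull_bound {𝒰 : Set (Set X)} (h : HasFiniteSubcover 𝒰)
    (α : G → X → X) (n : ℕ) :
    ∃ b : ℕ, ∀ g : Fin n → G,
      HasFiniteSubcover (joinPull α 𝒰 g) ∧ coverN (joinPull α 𝒰 g) ≤ b := by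
  obtain ⟨F, hF, hcov⟩ := h
  refine ⟨Fintype.card (Fin n → F), fun g => ?_⟩
  let A : (Fin n → F) → Set X := fun φ => ⋂ i, α (g i) ⁻¹' (φ i : Set X)
  have hA : ∀ φ, ∃ U ∈ joinPull α 𝒰 g, A φ ⊆ U := fun φ =>
    ⟨A φ, ⟨fun i => φ i, fun i => hF (φ i).2, rfl⟩, Subset.rfl⟩
  have hAcov : ∀ x, ∃ φ, x ∈ A φ := fun x => by
    have hx : ∀ i, ∃ U : F, α (g i) x ∈ (U : Set X) := fun i => by
      obtain ⟨U, hU, hxU⟩ := hcov.ge (mem_univ (α (g i) x))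
      exact ⟨⟨U, hU⟩, hxU⟩
    choose φ hφ using hx
    exact ⟨φ, mem_iInter.mpr hφ⟩
  obtain ⟨F', hF', hcov', -⟩ := exists_subcover_card_le_of_family A hA hAcov
  exact ⟨⟨F', hF', hcov'⟩, coverN_le_card_of_family A hA hAcov⟩

theorem HasFiniteSubcover.joinPull {𝒰 : Set (Set X)} (h : HasFiniteSubcover 𝒰)
    (α : G → X → X) {n : ℕ} (g : Fin n → G) : HasFiniteSubcover (joinPull α 𝒰 g) :=
  ((h.joinPull_bound α n).choose_spec g).1

theorem HasFiniteSubcover.coverN_le_patN {𝒰 : Set (Set X)} (h : HasFiniteSubcover 𝒰)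
    (α : G → X → X) {n : ℕ} (g : Fin n → G) :
    coverN (_root_.joinPull α 𝒰 g) ≤ patN α 𝒰 n := by
  obtain ⟨b, hb⟩ := h.joinPull_bound α n
  refine le_csSup ⟨b, ?_⟩ ⟨g, rfl⟩
  rintro _ ⟨g', rfl⟩
  exact (hb g').2

theorem patN_le {𝒰 : Set (Set X)} {α : G → X → X} {n b : ℕ}
    (h : ∀ g : Fin n → G, coverN (joinPull α 𝒰 g) ≤ b) : patN α 𝒰 n ≤ b := by
  refine csSup_le' ?_
  rintro _ ⟨g, rfl⟩
  exact h g

theorem HasFiniteSubcover.exists_patN_eq [Nonempty G] {𝒰 : Set (Set X)}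
    (h : HasFiniteSubcover 𝒰) (α : G → X → X) (n : ℕ) :
    ∃ g : Fin n → G, patN α 𝒰 n = coverN (_root_.joinPull α 𝒰 g) := by
  obtain ⟨b, hb⟩ := h.joinPull_bound α n
  refine Nat.sSup_mem (s := {m : ℕ | ∃ g : Fin n → G, m = coverN (_root_.joinPull α 𝒰 g)})
    ⟨_, fun _ => Classical.arbitrary G, rfl⟩ ⟨b, ?_⟩
  rintro _ ⟨g', rfl⟩
  exact (hb g').2

theorem Real.log_natCast_le_log_natCast {a b : ℕ} (h : a ≤ b) :
    Real.log (a : ℝ) ≤ Real.log (b : ℝ) := by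
  rcases Nat.eq_zero_or_pos a with rfl | ha
  · simpa using Real.log_natCast_nonneg b
  · exact Real.log_le_log (by exact_mod_cast ha) (by exact_mod_cast h)

theorem ENNReal.ofReal_log_pow_div (p k n : ℕ) :
    ENNReal.ofReal (Real.log ((p ^ k : ℕ) : ℝ) / n) =
      (k : ℝ≥0∞) * ENNReal.ofReal (Real.log p / n) := by
  rw [Nat.cast_pow, Real.log_pow, mul_div_assoc, ENNReal.ofReal_mul (Nat.cast_nonneg k),
    ENNReal.ofReal_natCast]

theorem natCast_mul_patEntCover (α : G → X → X) (𝒰 : Set (Set X)) (k : ℕ) :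
    (k : ℝ≥0∞) * patEntCover α 𝒰 =
      Filter.atTop.limsup fun n : ℕ =>
        ENNReal.ofReal (Real.log ((patN α 𝒰 n ^ k : ℕ) : ℝ) / n) := by
  simp_rw [ENNReal.ofReal_log_pow_div]
  exact (ENNReal.limsup_const_mul_of_ne_top (ENNReal.natCast_ne_top k)).symm

theorem limsup_log_div_le {a b : ℕ → ℕ} (h : ∀ n, a n ≤ b n) :
    (Filter.atTop.limsup fun n : ℕ => ENNReal.ofReal (Real.log (a n) / n)) ≤
      Filter.atTop.limsup fun n : ℕ => ENNReal.ofReal (Real.log (b n) / n) := by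
  refine limsup_le_limsup (Eventually.of_forall fun n => ENNReal.ofReal_le_ofReal ?_)
  exact div_le_div_of_nonneg_right (Real.log_natCast_le_log_natCast (h n)) (Nat.cast_nonneg n)

theorem isOpenCover_range_ball [PseudoMetricSpace X] {δ : ℝ} (hδ : 0 < δ) :
    IsOpenCover (range fun x : X => Metric.ball x δ) := by
  refine ⟨?_, eq_univ_of_forall fun x => ⟨_, ⟨x, rfl⟩, Metric.mem_ball_self hδ⟩⟩
  rintro _ ⟨x, rfl⟩
  exact Metric.isOpen_ball

theorem IsOpenCover.exists_ball_subset [PseudoMetricSpace X] [CompactSpace X]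
    {𝒰 : Set (Set X)} (h : IsOpenCover 𝒰) :
    ∃ δ > 0, ∀ x, ∃ U ∈ 𝒰, Metric.ball x δ ⊆ U := by
  obtain ⟨δ, hδ, hb⟩ := lebesgue_number_lemma_of_metric_sUnion isCompact_univ h.1 h.2.ge
  exact ⟨δ, hδ, fun x => hb x (mem_univ x)⟩

theorem exists_separated_card_ge_coverN [PseudoMetricSpace X] [CompactSpace X]
    (α : G → X → X) {𝒱 : Set (Set X)} {δ : ℝ} (hδ : 0 < δ)
    (h𝒱 : ∀ x, ∃ V ∈ 𝒱, Metric.ball x δ ⊆ V) {n : ℕ} (g : Fin n → G) :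
    ∃ E : Finset X, coverN (joinPull α 𝒱 g) ≤ E.card ∧
      ∀ x ∈ E, ∀ y ∈ E, (∀ i, dist (α (g i) x) (α (g i) y) < δ) → x = y := by
  let P : Finset X → Prop := fun E =>
    ∀ x ∈ E, ∀ y ∈ E, (∀ i, dist (α (g i) x) (α (g i) y) < δ) → x = y
  have hfin := ((isOpenCover_range_ball (X := X) (half_pos hδ)).hasFiniteSubcover).joinPull α g
  have hbdd : BddAbove {m | ∃ E, P E ∧ E.card = m} := by
    refine ⟨coverN (joinPull α (range fun x : X => Metric.ball x (δ / 2)) g), ?_⟩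
    rintro _ ⟨E, hE, rfl⟩
    refine card_le_coverN hfin E ?_
    rintro _ ⟨U, hU, rfl⟩ x hx y hy hxU hyU
    refine hE x hx y hy fun i => ?_
    have hxi := mem_iInter.mp hxU i
    have hyi := mem_iInter.mp hyU i
    obtain ⟨c, hc⟩ := hU i
    rw [← hc, mem_preimage, Metric.mem_ball] at hxi hyi
    linarith [dist_triangle_right (α (g i) x) (α (g i) y) c]
  obtain ⟨E, hE, hcard⟩ := Nat.sSup_mem (s := {m | ∃ E, P E ∧ E.card = m})
    ⟨0, ∅, by simp [P], rfl⟩ hbdd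
  refine ⟨E, ?_, hE⟩
  rw [← Fintype.card_coe E]
  refine coverN_le_card_of_family
    (fun y : E => ⋂ i, α (g i) ⁻¹' Metric.ball (α (g i) y) δ) (fun y => ?_) fun x => ?_
  · choose V hV hb using h𝒱
    exact ⟨_, ⟨fun i => V (α (g i) y), fun i => hV _, rfl⟩,
      iInter_mono fun i => preimage_mono (hb _)⟩
  · by_contra! hx
    have hfar : ∀ y ∈ E, ¬ ∀ i, dist (α (g i) x) (α (g i) y) < δ := fun y hy hlt =>
      hx ⟨y, hy⟩ (mem_iInter.mpr hlt)
    have hxE : x ∉ E := fun h => hfar x h fun i => by simpa using hδ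
    have hins : P (insert x E) := by
      intro a ha b hb hab
      rcases Finset.mem_insert.mp ha with rfl | haE <;>
        rcases Finset.mem_insert.mp hb with rfl | hbE
      · rfl
      · exact (hfar b hbE hab).elim
      · exact (hfar a haE fun i => by rw [dist_comm]; exact hab i).elim
      · exact hE a haE b hbE hab
    have := le_csSup hbdd ⟨insert x E, hins, rfl⟩
    rw [Finset.card_insert_of_notMem hxE] at this
    omega

end CoverNumber

namespace CoInd

variable {G X : Type*} [Group G] {H : Subgroup G}

theorem rmul_mk (g₀ g : G) :
    rmul H g₀ (Quotient.mk'' g) = Quotient.mk'' (g * g₀) := rfl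

theorem rmul_inv_rmul (g : G) (θ : RQ H) : rmul H g⁻¹ (rmul H g θ) = θ := by
  induction θ using Quotient.inductionOn' with
  | h a => simp [rmul_mk]

theorem rmul_of_mem_center (hZ : H ≤ Subgroup.center G) (h : H) (θ : RQ H) :
    rmul H h θ = θ := by
  induction θ using Quotient.inductionOn' with
  | h a =>
    rw [rmul_mk, Quotient.eq'', QuotientGroup.rightRel_apply,
      Subgroup.mem_center_iff.mp (hZ h.2) a]
    simp

theorem IsSection.cocycle_mem {s : RQ H → G} (hs : IsSection H s) (g : G) (θ : RQ H) :
    s θ * g * (s (rmul H g θ))⁻¹ ∈ H := by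
  rw [← QuotientGroup.rightRel_apply, ← Quotient.eq'', hs.1, ← rmul_mk, hs.1]

/-- The cocycle `(θ, g) ↦ s(θ) g s(θ g)⁻¹` with values in `H`. -/
def cocycle {s : RQ H → G} (hs : IsSection H s) (g : G) (θ : RQ H) : H :=
  ⟨s θ * g * (s (rmul H g θ))⁻¹, hs.cocycle_mem g θ⟩

theorem coindAct_apply {s : RQ H → G} (hs : IsSection H s) (α : H → X → X) (g : G)
    (f : RQ H → X) (θ : RQ H) :
    coindAct H α s g f θ = α (cocycle hs g θ) (f (rmul H g θ)) :=
  dif_pos (hs.cocycle_mem g θ)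

theorem coindAct_apply_of_central (hZ : H ≤ Subgroup.center G) {s : RQ H → G}
    (hs : IsSection H s) (α : H → X → X) (h : H) (f : RQ H → X) (θ : RQ H) :
    coindAct H α s h f θ = α h (f θ) := by
  have hc : cocycle hs (h : G) θ = h := Subtype.ext <| by
    change s θ * h * (s (rmul H h θ))⁻¹ = h
    rw [rmul_of_mem_center hZ, Subgroup.mem_center_iff.mp (hZ h.2) (s θ), mul_inv_cancel_right]
  rw [coindAct_apply hs, hc, rmul_of_mem_center hZ]

variable [Fintype (RQ H)]

theorem patN_coindAct_le {s : RQ H → G} (hs : IsSection H s) (α : H → X → X)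
    {𝒰 : Set (Set (RQ H → X))} {𝒱 : Set (Set X)} (h𝒱 : HasFiniteSubcover 𝒱)
    (hpi : ∀ V : RQ H → Set X, (∀ θ, V θ ∈ 𝒱) → ∃ U ∈ 𝒰, univ.pi V ⊆ U) (n : ℕ) :
    patN (coindAct H α s) 𝒰 n ≤ patN α 𝒱 n ^ Fintype.card (RQ H) := by
  refine patN_le fun g => ?_
  let h : RQ H → Fin n → H := fun η i => cocycle hs (g i) (rmul H (g i)⁻¹ η)
  choose F hF hcard hcov using fun η => (h𝒱.joinPull α (h η)).exists_card_eq_coverN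
  refine (coverN_le_card_of_family (ι := ∀ η, F η)
    (fun φ => univ.pi fun η => (φ η : Set X)) (fun φ => ?_) fun f => ?_).trans ?_
  · choose V hV hφ using fun η => hF η (φ η).2
    choose U hU hVU using fun i => hpi (fun θ => V (rmul H (g i) θ) i) fun θ => hV _ i
    refine ⟨_, ⟨U, hU, rfl⟩, fun f hf => mem_iInter.mpr fun i => hVU i fun θ _ => ?_⟩
    have hfη : f (rmul H (g i) θ) ∈ (φ (rmul H (g i) θ) : Set X) := hf _ (mem_univ _)
    rw [hφ] at hfη
    have hfi := mem_iInter.mp hfη i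
    simp only [h, rmul_inv_rmul] at hfi
    rw [coindAct_apply hs]
    exact hfi
  · have hf : ∀ η, ∃ V : F η, f η ∈ (V : Set X) := fun η => by
      obtain ⟨V, hV, hfV⟩ := (hcov η).ge (mem_univ (f η))
      exact ⟨⟨V, hV⟩, hfV⟩
    choose φ hφ using hf
    exact ⟨φ, fun η _ => hφ η⟩
  · rw [Fintype.card_pi]
    refine (Finset.prod_le_pow_card _ _ (patN α 𝒱 n) fun η _ => ?_)
    rw [Fintype.card_coe, hcard]
    exact h𝒱.coverN_le_patN α _

theorem le_patN_coindAct (hZ : H ≤ Subgroup.center G) {s : RQ H → G} (hs : IsSection H s)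
    [PseudoMetricSpace X] [CompactSpace X] (α : H → X → X) {𝒱 : Set (Set X)} {δ : ℝ}
    (hδ : 0 < δ) (hb : ∀ x, ∃ V ∈ 𝒱, Metric.ball x δ ⊆ V) (h𝒱 : HasFiniteSubcover 𝒱) (n : ℕ) :
    patN α 𝒱 n ^ Fintype.card (RQ H) ≤
      patN (coindAct H α s) (range fun f : RQ H → X => Metric.ball f (δ / 2)) n := by
  obtain ⟨g, hg⟩ := h𝒱.exists_patN_eq α n
  obtain ⟨E, hcard, hE⟩ := exists_separated_card_ge_coverN α hδ hb g
  have hfin := (isOpenCover_range_ball (X := RQ H → X) (half_pos hδ)).hasFiniteSubcover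
  rw [hg]
  refine (Nat.pow_le_pow_left hcard _).trans ?_
  rw [← Finset.card_univ (α := RQ H), ← Finset.prod_const, ← Fintype.card_piFinset]
  refine (card_le_coverN (hfin.joinPull (coindAct H α s) fun i => (g i : G)) _ ?_).trans
    (hfin.coverN_le_patN _ _)
  rintro _ ⟨U, hU, rfl⟩ x hx y hy hxU hyU
  rw [Fintype.mem_piFinset] at hx hy
  refine funext fun θ => hE _ (hx θ) _ (hy θ) fun i => ?_
  have hxi := mem_iInter.mp hxU i
  have hyi := mem_iInter.mp hyU i
  obtain ⟨c, hc⟩ := hU i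
  rw [← hc, mem_preimage, Metric.mem_ball] at hxi hyi
  rw [← coindAct_apply_of_central hZ hs α (g i) x, ← coindAct_apply_of_central hZ hs α (g i) y]
  refine (dist_le_pi_dist _ _ θ).trans_lt ?_
  linarith [dist_triangle_right (coindAct H α s (g i) x) (coindAct H α s (g i) y) c]

theorem card_rightQuotient (H : Subgroup G) [Fintype (RQ H)] :
    Fintype.card (RQ H) = H.index := by
  rw [← Nat.card_eq_fintype_card, Subgroup.index]
  exact Nat.card_congr (QuotientGroup.quotientRightRelEquivQuotientLeftRel H)

end CoInd

/-- Theorem 3.4: if `H ⊆ Z(G)` and `[G:H] < ∞`, then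
`h*_top(X_H^G,G) = [G:H] · h*_top(X,H)`. -/
theorem coinduced_maximal_pattern_entropy_of_central
    {G X : Type*} [Group G] [Countable G] [Infinite G] [MetricSpace X] [CompactSpace X]
    (H : Subgroup G) (hZ : H ≤ Subgroup.center G) (hH : H.index ≠ 0)
    (α : ↥H → X → X) (hα : IsActionBy α)
    (s : CoInd.RQ H → G) (hs : CoInd.IsSection H s) :
    patEnt (CoInd.coindAct H α s) = (H.index : ℝ≥0∞) * patEnt α := by
  have : H.FiniteIndex := ⟨hH⟩
  have : Finite (CoInd.RQ H) :=
    Finite.of_equiv _ (QuotientGroup.quotientRightRelEquivQuotientLeftRel H).symm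
  have := Fintype.ofFinite (CoInd.RQ H)
  rw [← CoInd.card_rightQuotient H]
  refine le_antisymm (iSup₂_le fun 𝒰 h𝒰 => ?_) ?_
  · obtain ⟨δ, hδ, hb⟩ := IsOpenCover.exists_ball_subset h𝒰
    have hcov := isOpenCover_range_ball (X := X) hδ
    refine le_trans ?_ (mul_le_mul_right
      (le_iSup₂_of_le (range fun x : X => Metric.ball x δ) hcov le_rfl) _)
    rw [natCast_mul_patEntCover]
    refine limsup_log_div_le (CoInd.patN_coindAct_le hs α hcov.hasFiniteSubcover fun V hV => ?_)
    choose c hc using hV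
    obtain ⟨U, hU, hcU⟩ := hb c
    refine ⟨U, hU, ?_⟩
    rwa [ball_pi c hδ, funext hc] at hcU
  · simp_rw [patEnt, ENNReal.mul_iSup]
    refine iSup₂_le fun 𝒱 h𝒱 => ?_
    obtain ⟨δ, hδ, hb⟩ := IsOpenCover.exists_ball_subset h𝒱
    refine le_iSup₂_of_le _ (isOpenCover_range_ball (X := CoInd.RQ H → X) (half_pos hδ)) ?_
    rw [natCast_mul_patEntCover]
    exact limsup_log_div_le
      (CoInd.le_patN_coindAct hZ hs α hδ hb (IsOpenCover.hasFiniteSubcover h𝒱))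
end

section
/- Let G be a countably infinite discrete group, H ≤ G a subgroup of infinite index, s: H\G → G a section of the right cosets, K a nonempty finite subset of H\G, and F a nonempty finite subset of G. Then the set G \ (⋃_{g∈F} ⋃_{θ∈K} ⋃_{φ∈K} s(θ)^{-1} H s(φ) g) is nonempty, and moreover infinite. -/
open Filter Topology Set
open scoped ENNReal Classical

open scoped Pointwise in
/-- If `H` has infinite index in an infinite group, finitely many sets `a H b` miss
infinitely many elements. -/
theorem Subgroup.infinite_compl_biUnion_mul_mul {G : Type*} [Group G] [Infinite G]
    (H : Subgroup G) (hH : H.index = 0) (T : Finset (G × G)) :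
    ((⋃ p ∈ T, {x : G | ∃ h ∈ H, x = p.1 * h * p.2})ᶜ).Infinite := by
  intro hfin
  let K : (G × G) ⊕ G → Subgroup G :=
    Sum.elim (fun p => H.map (MulAut.conj p.2⁻¹).toMonoidHom) fun _ => ⊥
  let t : (G × G) ⊕ G → G := Sum.elim (fun p => p.1 * p.2) id
  have hcover : ⋃ i ∈ T.disjSum hfin.toFinset, t i • (K i : Set G) = Set.univ := by
    refine Set.eq_univ_of_forall fun x => ?_
    rw [Set.mem_iUnion₂]
    by_cases hx : x ∈ ⋃ p ∈ T, {x : G | ∃ h ∈ H, x = p.1 * h * p.2}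
    · obtain ⟨p, hp, h, hh, rfl⟩ := Set.mem_iUnion₂.mp hx
      refine ⟨Sum.inl p, Finset.inl_mem_disjSum.mpr hp, p.2⁻¹ * h * p.2, ⟨h, hh, ?_⟩, ?_⟩
      · simp
      · simp [t, mul_assoc]
    · exact ⟨Sum.inr x, Finset.inr_mem_disjSum.mpr (hfin.mem_toFinset.mpr hx), 1,
        one_mem (⊥ : Subgroup G), mul_one x⟩
  obtain ⟨i, -, hi⟩ := Subgroup.exists_finiteIndex_of_leftCoset_cover hcover
  refine hi.index_ne_zero ?_
  rcases i with p | g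
  · exact (H.index_map_equiv (MulAut.conj p.2⁻¹)).trans hH
  · exact Subgroup.index_bot.trans Nat.card_eq_zero_of_infinite

/-- Lemma 3.9, after Neumann: if `[G:H] = ∞`, then for any nonempty finite
`K ⊆ H\G` and `F ⊆ G`, the set `G \ ⋃_{g∈F} ⋃_{θ∈K} ⋃_{φ∈K} s(θ)⁻¹ H s(φ) g` is nonempty
and infinite. -/
theorem compl_finite_union_conjugate_cosets_infinite
    {G : Type*} [Group G] [Countable G] [Infinite G] (H : Subgroup G) (hH : H.index = 0)
    (s : CoInd.RQ H → G) (hs : CoInd.IsSection H s)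
    (K : Finset (CoInd.RQ H)) (hK : K.Nonempty) (F : Finset G) (hF : F.Nonempty) :
    ((⋃ g ∈ F, ⋃ θ ∈ K, ⋃ φ ∈ K,
        {x : G | ∃ h ∈ H, x = (s θ)⁻¹ * h * s φ * g})ᶜ).Nonempty ∧
      ((⋃ g ∈ F, ⋃ θ ∈ K, ⋃ φ ∈ K,
        {x : G | ∃ h ∈ H, x = (s θ)⁻¹ * h * s φ * g})ᶜ).Infinite := by
  have hinf := (H.infinite_compl_biUnion_mul_mul hH
    ((F ×ˢ K ×ˢ K).image fun q => ((s q.2.1)⁻¹, s q.2.2 * q.1))).mono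
    (t := (⋃ g ∈ F, ⋃ θ ∈ K, ⋃ φ ∈ K, {x : G | ∃ h ∈ H, x = (s θ)⁻¹ * h * s φ * g})ᶜ) <| by
    refine Set.compl_subset_compl.mpr fun x hx => ?_
    simp only [Set.mem_iUnion] at hx
    obtain ⟨g, hg, θ, hθ, φ, hφ, h, hh, rfl⟩ := hx
    exact Set.mem_iUnion₂.mpr ⟨((s θ)⁻¹, s φ * g), Finset.mem_image.mpr
      ⟨(g, θ, φ), by simp [hg, hθ, hφ], rfl⟩, h, hh, mul_assoc _ _ _⟩
  exact ⟨hinf.nonempty, hinf⟩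
end

section
/- Let G be a countably infinite discrete group, H ≤ G a subgroup with [G:H] = +∞, and (X,H,α) a topological dynamical system where X contains at least two distinct points. Let (X_H^G, G, α^{H\G}) be the co-induced system. Then IN_k(X_H^G, G) = (X_H^G)^k for every k ∈ ℕ, and h*_{top}(X_H^G, G) = +∞. -/
open Filter Topology Set
open scoped ENNReal Classical

section Covers

variable {G Y W : Type*}

theorem joinPull_sUnion {α : G → Y → Y} {𝒰 : Set (Set Y)} (h𝒰 : ⋃₀ 𝒰 = Set.univ) {n : ℕ}
    (g : Fin n → G) : ⋃₀ joinPull α 𝒰 g = Set.univ := by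
  refine Set.eq_univ_of_forall fun y => ?_
  have hy : ∀ i, ∃ U ∈ 𝒰, α (g i) y ∈ U := fun i => by
    simpa using (Set.eq_univ_iff_forall.1 h𝒰) (α (g i) y)
  choose U hU hyU using hy
  exact ⟨_, ⟨U, hU, rfl⟩, Set.mem_iInter.2 hyU⟩

theorem joinPull_range (α : G → Y → Y) (U : W → Set Y) {n : ℕ} (g : Fin n → G) :
    joinPull α (Set.range U) g =
      Set.range fun v : Fin n → W => ⋂ i, α (g i) ⁻¹' U (v i) := by
  ext V
  constructor
  · rintro ⟨A, hA, rfl⟩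
    choose v hv using hA
    exact ⟨v, by simp only [hv]⟩
  · rintro ⟨v, rfl⟩
    exact ⟨fun i => U (v i), fun i => ⟨v i, rfl⟩, rfl⟩

theorem coverN_joinPull_range_le [Fintype W] (α : G → Y → Y) {U : W → Set Y}
    (hU : ⋃₀ Set.range U = Set.univ) {n : ℕ} (g : Fin n → G) :
    coverN (joinPull α (Set.range U) g) ≤ Fintype.card W ^ n := by
  let F : Finset (Set Y) :=
    Finset.univ.image fun v : Fin n → W => ⋂ i, α (g i) ⁻¹' U (v i)
  have hF : (F : Set (Set Y)) = joinPull α (Set.range U) g := by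
    simp [F, joinPull_range]
  have hle : coverN (joinPull α (Set.range U) g) ≤ F.card :=
    Nat.sInf_le ⟨F, hF.le, rfl, by rw [hF]; exact joinPull_sUnion hU g⟩
  refine hle.trans (Finset.card_image_le.trans ?_)
  simp

/-- The set of points lying in none of the `C w'` with `w' ≠ w`. -/
def avoidOthers (C : W → Set Y) (w : W) : Set Y := ⋂ w' ∈ {w' | w' ≠ w}, (C w')ᶜ

theorem mem_avoidOthers {C : W → Set Y} {w : W} {y : Y} :
    y ∈ avoidOthers C w ↔ ∀ w', w' ≠ w → y ∉ C w' := by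
  simp [avoidOthers]

theorem isOpenCover_avoidOthers [TopologicalSpace Y] [Finite W] [Nonempty W] {C : W → Set Y}
    (hC : ∀ w, IsClosed (C w)) (hdisj : Pairwise fun w w' => Disjoint (C w) (C w')) :
    IsOpenCover (Set.range (avoidOthers C)) := by
  constructor
  · rintro _ ⟨w, rfl⟩
    exact (Set.toFinite _).isOpen_biInter fun w' _ => (hC w').isOpen_compl
  · refine Set.eq_univ_of_forall fun y => ?_
    rw [Set.sUnion_range, Set.mem_iUnion]
    by_cases h : ∃ w, y ∈ C w
    · obtain ⟨w, hw⟩ := h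
      exact ⟨w, mem_avoidOthers.2 fun w' hw' hy =>
        Set.disjoint_left.1 (hdisj hw') hy hw⟩
    · obtain ⟨w⟩ := ‹Nonempty W›
      exact ⟨w, mem_avoidOthers.2 fun w' _ hy => h ⟨w', hy⟩⟩

theorem card_pow_le_coverN [Fintype W] {α : G → Y → Y} {C : W → Set Y} {n : ℕ}
    {g : Fin n → G} (hcov : ⋃₀ Set.range (avoidOthers C) = Set.univ)
    (hg : ∀ v : Fin n → W, ∃ y, ∀ i, α (g i) y ∈ C (v i)) :
    Fintype.card W ^ n ≤ coverN (joinPull α (Set.range (avoidOthers C)) g) := by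
  have hne : {m : ℕ | ∃ F : Finset (Set Y), ↑F ⊆ joinPull α (Set.range (avoidOthers C)) g ∧
      F.card = m ∧ ⋃₀ (F : Set (Set Y)) = Set.univ}.Nonempty := by
    have hfin : (joinPull α (Set.range (avoidOthers C)) g).Finite := by
      rw [joinPull_range]
      exact Set.finite_range _
    exact ⟨_, hfin.toFinset, by simp, rfl, by simpa using joinPull_sUnion hcov g⟩
  refine le_csInf hne ?_
  rintro _ ⟨F, hF, rfl, hFcov⟩
  choose y hy using hg
  have hmem : ∀ v, ∃ V ∈ F, y v ∈ V := fun v => by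
    simpa using (Set.eq_univ_iff_forall.1 hFcov) (y v)
  choose E hE hyE using hmem
  have key : ∀ v v', y v ∈ E v' → E v' = ⋂ i, α (g i) ⁻¹' avoidOthers C (v i) := by
    intro v v' h
    have hj := hF (hE v')
    rw [joinPull_range] at hj
    obtain ⟨u, hu⟩ := hj
    rw [← hu] at h ⊢
    have huv : u = v := by
      funext i
      by_contra hne
      exact mem_avoidOthers.1 (Set.mem_iInter.1 h i) (v i) (Ne.symm hne) (hy v i)
    rw [huv]
  have hinj : Function.Injective E := by
    intro v v' h
    have h1 : y v ∈ ⋂ i, α (g i) ⁻¹' avoidOthers C (v' i) := by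
      rw [← key v' v' (hyE v'), ← h]
      exact hyE v
    funext i
    by_contra hne
    exact mem_avoidOthers.1 (Set.mem_iInter.1 h1 i) (v i) hne (hy v i)
  have hcard := Finset.card_le_card_of_injOn (s := Finset.univ) (t := F) E
    (fun v _ => hE v) hinj.injOn
  simpa using hcard

theorem log_card_le_patEnt [TopologicalSpace Y] [Fintype W] [Nonempty W] {α : G → Y → Y}
    {C : W → Set Y} (hC : ∀ w, IsClosed (C w))
    (hdisj : Pairwise fun w w' => Disjoint (C w) (C w')) (g : ℕ → G)
    (hg : ∀ (n : ℕ) (v : Fin n → W), ∃ y, ∀ i, α (g i) y ∈ C (v i)) :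
    ENNReal.ofReal (Real.log (Fintype.card W)) ≤ patEnt α := by
  have hcover := isOpenCover_avoidOthers hC hdisj
  refine le_trans ?_ (le_iSup₂ (f := fun 𝒰 _ => patEntCover α 𝒰) _ hcover)
  have hpat : ∀ n, Fintype.card W ^ n ≤ patN α (Set.range (avoidOthers C)) n := fun n => by
    refine (card_pow_le_coverN (g := fun i : Fin n => g i) hcover.2 (hg n)).trans ?_
    refine le_csSup ⟨Fintype.card W ^ n, ?_⟩ ⟨_, rfl⟩
    rintro _ ⟨g', rfl⟩
    exact coverN_joinPull_range_le α hcover.2 g'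
  calc ENNReal.ofReal (Real.log (Fintype.card W))
      = Filter.atTop.limsup fun _ : ℕ => ENNReal.ofReal (Real.log (Fintype.card W)) :=
        (Filter.limsup_const _).symm
    _ ≤ patEntCover α (Set.range (avoidOthers C)) := by
      refine Filter.limsup_le_limsup ?_
      filter_upwards [Filter.eventually_gt_atTop 0] with n hn
      have hn' : (0 : ℝ) < n := by exact_mod_cast hn
      refine ENNReal.ofReal_le_ofReal ?_
      rw [le_div_iff₀ hn', mul_comm, ← Real.log_pow]
      refine Real.log_le_log (pow_pos (by exact_mod_cast Fintype.card_pos) n) ?_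
      exact_mod_cast hpat n

end Covers

namespace CoInd

variable {G : Type*} [Group G] {H : Subgroup G} {s : RQ H → G} {X : Type*}

theorem rmul_injective (g : G) : Function.Injective (rmul H g) := by
  intro a b
  induction a using Quotient.inductionOn'
  induction b using Quotient.inductionOn'
  intro h
  have h' := Quotient.exact' h
  refine Quotient.sound' ?_
  rw [QuotientGroup.rightRel_apply] at h' ⊢
  simpa [mul_assoc] using h'

theorem IsSection.mul_inv_mem (hs : IsSection H s) (g : G) (θ : RQ H) :
    s θ * g * (s (rmul H g θ))⁻¹ ∈ H := by
  have h : (Quotient.mk'' (s (rmul H g θ)) : RQ H) = Quotient.mk'' (s θ * g) := by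
    rw [hs.1]
    conv_lhs => rw [← hs.1 θ]
    rfl
  have h' := Quotient.exact' h
  rwa [QuotientGroup.rightRel_apply] at h'

open scoped Pointwise in
/-- A consequence of B. H. Neumann's lemma on coverings by cosets. -/
theorem exists_rmul_ne (hH : H.index = 0) (hs : IsSection H s) (S T : Finset (RQ H)) :
    ∃ g : G, ∀ a ∈ T, ∀ b ∈ S, rmul H g a ≠ b := by
  by_contra! hcon
  have hcov : ⋃ p ∈ T ×ˢ S, ((s p.1)⁻¹ * s p.2) •
      ((H.map (MulAut.conj (s p.2)⁻¹).toMonoidHom : Subgroup G) : Set G) = Set.univ := by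
    refine Set.eq_univ_of_forall fun g => ?_
    obtain ⟨a, ha, b, hb, hab⟩ := hcon g
    have hmem := hs.mul_inv_mem g a
    rw [hab] at hmem
    simp only [Set.mem_iUnion]
    refine ⟨(a, b), Finset.mem_product.2 ⟨ha, hb⟩, ?_⟩
    rw [Set.mem_smul_set_iff_inv_smul_mem]
    refine ⟨_, hmem, ?_⟩
    simp [mul_assoc]
  obtain ⟨p, -, hp⟩ := Subgroup.exists_finiteIndex_of_leftCoset_cover hcov
  refine hp.index_ne_zero ?_
  rw [← hH]
  exact H.index_map_equiv (MulAut.conj (s p.2)⁻¹)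

theorem exists_seq_disjoint_rmul (hH : H.index = 0) (hs : IsSection H s) (T : Finset (RQ H)) :
    ∃ g : ℕ → G, ∀ m n, m ≠ n → ∀ a ∈ T, ∀ b ∈ T, rmul H (g m) a ≠ rmul H (g n) b := by
  obtain ⟨g, -, hg⟩ := exists_seq_of_forall_finset_exists (fun _ : G => True)
    (fun x y => ∀ a ∈ T, ∀ b ∈ T, rmul H x a ≠ rmul H y b) fun F _ => by
      obtain ⟨y, hy⟩ := exists_rmul_ne hH hs (F.biUnion fun x => T.image (rmul H x)) T
      refine ⟨y, trivial, fun x hx a ha b hb hab => hy b hb _ ?_ hab.symm⟩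
      exact Finset.mem_biUnion.2 ⟨x, hx, Finset.mem_image_of_mem _ ha⟩
  refine ⟨g, fun m n hmn a ha b hb => ?_⟩
  rcases lt_or_gt_of_ne hmn with h | h
  · exact hg m n h a ha b hb
  · exact (hg n m h b hb a ha).symm

theorem exists_coindAct_eq [TopologicalSpace X] {ι : Type*} {α : ↥H → X → X}
    (hα : IsActionBy α) (hs : IsSection H s) {T : Finset (RQ H)} {g : ι → G}
    (hg : ∀ i j, i ≠ j → ∀ a ∈ T, ∀ b ∈ T, rmul H (g i) a ≠ rmul H (g j) b)
    (y : ι → RQ H → X) (f₀ : RQ H → X) :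
    ∃ f, ∀ i, ∀ θ ∈ T, coindAct H α s (g i) f θ = y i θ := by
  let c : ι → RQ H → H := fun i θ => ⟨_, hs.mul_inv_mem (g i) θ⟩
  let e : ι × T → RQ H := fun p => rmul H (g p.1) p.2
  have he : Function.Injective e := by
    rintro ⟨i, a, ha⟩ ⟨j, b, hb⟩ h
    obtain rfl : i = j := by
      by_contra hij
      exact hg i j hij a ha b hb h
    obtain rfl : a = b := rmul_injective _ h
    rfl
  refine ⟨Function.extend e (fun p => α (c p.1 p.2)⁻¹ (y p.1 p.2)) f₀, fun i θ hθ => ?_⟩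
  have hval := he.extend_apply (fun p => α (c p.1 p.2)⁻¹ (y p.1 p.2)) f₀ (i, ⟨θ, hθ⟩)
  rw [coindAct, dif_pos (hs.mul_inv_mem (g i) θ)]
  change α (c i θ) (Function.extend e _ f₀ (e (i, ⟨θ, hθ⟩))) = y i θ
  rw [hval, ← hα.2.1, mul_inv_cancel, hα.1]

theorem isINTuple_coindAct [TopologicalSpace X] [Nonempty X] {α : ↥H → X → X}
    (hα : IsActionBy α) (hH : H.index = 0) (hs : IsSection H s) {k : ℕ}
    (x : Fin k → RQ H → X) : IsINTuple (coindAct H α s) x := by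
  intro U hU hx n
  choose I u hu hIU using fun i => isOpen_pi_iff.1 (hU i) (x i) (hx i)
  let θ₀ : RQ H := Quotient.mk'' 1
  let T : Finset (RQ H) := insert θ₀ (Finset.univ.biUnion I)
  obtain ⟨g, hg⟩ := exists_seq_disjoint_rmul hH hs T
  have hginj : Function.Injective g := by
    intro i j hij
    by_contra hne
    exact hg i j hne θ₀ (Finset.mem_insert_self _ _) θ₀ (Finset.mem_insert_self _ _) (by rw [hij])
  refine ⟨(Finset.range n).image g, ?_, fun F hF _ ω => ?_⟩
  · rw [Finset.card_image_of_injective _ hginj, Finset.card_range]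
  · obtain ⟨f, hf⟩ := exists_coindAct_eq hα hs hg (fun m => x (ω (g m)))
      (fun _ => Classical.arbitrary X)
    refine ⟨f, Set.mem_iInter₂.2 fun a ha => ?_⟩
    obtain ⟨m, -, rfl⟩ := Finset.mem_image.1 (hF ha)
    refine hIU _ fun θ hθ => ?_
    rw [hf m θ (Finset.mem_insert_of_mem (Finset.mem_biUnion.2 ⟨_, Finset.mem_univ _, hθ⟩))]
    exact (hu _ θ hθ).2

theorem mul_log_two_le_patEnt_coindAct [TopologicalSpace X] [T1Space X] [Nontrivial X]
    {α : ↥H → X → X} (hα : IsActionBy α) (hH : H.index = 0) (hs : IsSection H s)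
    (T : Finset (RQ H)) :
    ENNReal.ofReal (T.card * Real.log 2) ≤ patEnt (coindAct H α s) := by
  obtain ⟨a, b, hab⟩ := exists_pair_ne X
  obtain ⟨g, hg⟩ := exists_seq_disjoint_rmul hH hs T
  let p : (T → Bool) → T → X := fun w θ => if w θ then a else b
  let C : (T → Bool) → Set (RQ H → X) := fun w => ⋂ θ : T, {f | f θ = p w θ}
  have hC : ∀ w, IsClosed (C w) := fun w => isClosed_iInter fun θ =>
    isClosed_singleton.preimage (continuous_apply (θ : RQ H))
  have hdisj : Pairwise fun w w' => Disjoint (C w) (C w') := by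
    intro w w' hne
    refine Set.disjoint_left.2 fun f hf hf' => hne ?_
    funext θ
    have h : p w θ = p w' θ :=
      (Set.mem_iInter.1 hf θ).symm.trans (Set.mem_iInter.1 hf' θ)
    have hinj : Function.Injective fun c : Bool => if c then a else b := by
      intro c d hcd
      cases c <;> cases d <;> simp [hab, hab.symm] at hcd ⊢
    exact hinj h
  have hmain := log_card_le_patEnt (α := coindAct H α s) hC hdisj g fun n v => by
    obtain ⟨f, hf⟩ := exists_coindAct_eq (g := fun i : Fin n => g i) hα hs
      (fun i j hij => hg i j (Fin.val_injective.ne hij))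
      (fun i θ => if h : θ ∈ T then p (v i) ⟨θ, h⟩ else a) (fun _ => a)
    refine ⟨f, fun i => Set.mem_iInter.2 fun θ => ?_⟩
    simpa using hf i θ θ.2
  simpa using hmain

theorem patEnt_coindAct_eq_top [TopologicalSpace X] [T1Space X] [Nontrivial X]
    {α : ↥H → X → X} (hα : IsActionBy α) (hH : H.index = 0) (hs : IsSection H s) :
    patEnt (coindAct H α s) = ⊤ := by
  have hinf : Infinite (RQ H) := by
    have : Infinite (G ⧸ H) :=
      (Nat.card_eq_zero.1 hH).resolve_left (not_isEmpty_of_nonempty _)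
    exact (QuotientGroup.quotientRightRelEquivQuotientLeftRel H).infinite_iff.2 this
  refine ENNReal.eq_top_of_forall_nnreal_le fun r => ?_
  obtain ⟨m, hm⟩ := exists_nat_ge ((r : ℝ) / Real.log 2)
  obtain ⟨T, hT⟩ := Infinite.exists_subset_card_eq (RQ H) m
  refine le_trans ?_ (mul_log_two_le_patEnt_coindAct hα hH hs T)
  rw [← ENNReal.ofReal_coe_nnreal, hT]
  exact ENNReal.ofReal_le_ofReal ((div_le_iff₀ (Real.log_pos one_lt_two)).1 hm)

end CoInd

/-- Theorem 3.10: if `[G:H] = ∞` and `X` has at least two points, then every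
tuple of the co-induced system is an IN-tuple and `h*_top(X_H^G,G) = +∞`. -/
theorem coinduced_infiniteIndex_all_INTuples_and_infinite_entropy
    {G X : Type*} [Group G] [Countable G] [Infinite G]
    [MetricSpace X] [CompactSpace X] [Nontrivial X]
    (H : Subgroup G) (hH : H.index = 0) (α : ↥H → X → X) (hα : IsActionBy α)
    (s : CoInd.RQ H → G) (hs : CoInd.IsSection H s) :
    (∀ k : ℕ,
      {f : Fin k → (CoInd.RQ H → X) | IsINTuple (CoInd.coindAct H α s) f} = Set.univ) ∧
      patEnt (CoInd.coindAct H α s) = ⊤ := by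
  exact ⟨fun _ => Set.eq_univ_of_forall (CoInd.isINTuple_coindAct hα hH hs),
    CoInd.patEnt_coindAct_eq_top hα hH hs⟩
end
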